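/- arXiv:1707.07236 — 5 statements merged into one kernel-verified Lean document; each statement's English description precedes it below -/
import Mathlib

section
/- Let n ≥ 2 and let T be a real symmetric n×n matrix with tr(T) = 0. Then tr(T³) ≤ ((n−2)/√(n(n−1))) · ‖T‖³, where ‖T‖ is the Frobenius norm. -/
/-- The trace of a power of a real Hermitian matrix is the corresponding power sum of its
eigenvalues. -/
theorem trace_pow_eq_sum_eigenvalues_pow {ι : Type*} [Fintype ι] [DecidableEq ι]
    {A : Matrix ι ι ℝ} (hA : A.IsHermitian) (k : ℕ) :
    (A ^ k).trace = ∑ i, hA.eigenvalues i ^ k := by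
  conv_lhs => rw [hA.spectral_theorem, ← map_pow, Unitary.conjStarAlgAut_apply,
    Matrix.trace_mul_comm, ← mul_assoc, Unitary.coe_star_mul_self, one_mul, Matrix.diagonal_pow,
    Matrix.trace_diagonal]
  simp

/-- A member of a finite real family with zero sum is controlled by the sum of squares. -/
theorem card_mul_sq_le_of_sum_eq_zero {ι : Type*} [Fintype ι] (x : ι → ℝ)
    (hx : ∑ i, x i = 0) (i : ι) :
    (Fintype.card ι : ℝ) * x i ^ 2 ≤ ((Fintype.card ι : ℝ) - 1) * ∑ j, x j ^ 2 := by
  classical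
  have hcs := sq_sum_le_card_mul_sum_sq (s := Finset.univ.erase i) (f := x)
  have hsum := Finset.add_sum_erase Finset.univ x (Finset.mem_univ i)
  have hsq := Finset.add_sum_erase Finset.univ (fun j => x j ^ 2) (Finset.mem_univ i)
  rw [Finset.card_erase_of_mem (Finset.mem_univ i), Finset.card_univ,
    Nat.cast_pred (Fintype.card_pos_iff.mpr ⟨i⟩),
    show ∑ j ∈ Finset.univ.erase i, x j = -x i by linarith,
    show ∑ j ∈ Finset.univ.erase i, x j ^ 2 = (∑ j, x j ^ 2) - x i ^ 2 by linarith] at hcs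
  linarith

/-- The sharp bound for the sum of cubes of a finite real family with zero sum. -/
theorem sum_pow_three_le_of_sum_eq_zero {ι : Type*} [Fintype ι] (x : ι → ℝ)
    (hx : ∑ i, x i = 0) (hι : 2 ≤ Fintype.card ι) :
    ∑ i, x i ^ 3 ≤
      (((Fintype.card ι : ℝ) - 2) /
        Real.sqrt ((Fintype.card ι : ℝ) * ((Fintype.card ι : ℝ) - 1))) *
        Real.sqrt (∑ i, x i ^ 2) ^ 3 := by
  have hle := card_mul_sq_le_of_sum_eq_zero x hx
  have hn : (2 : ℝ) ≤ Fintype.card ι := by exact_mod_cast hι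
  have hcard : ∑ _i : ι, (1 : ℝ) = Fintype.card ι := by simp
  generalize (Fintype.card ι : ℝ) = n at *
  have hS : 0 ≤ ∑ i, x i ^ 2 := Finset.sum_nonneg fun i _ => sq_nonneg _
  have hr2 := Real.sq_sqrt hS
  have hr := Real.sqrt_nonneg (∑ i, x i ^ 2)
  have hp : 0 < n * (n - 1) := mul_pos (by linarith) (by linarith)
  have hs2 := Real.sq_sqrt hp.le
  have hs := Real.sqrt_pos.mpr hp
  set r := Real.sqrt (∑ i, x i ^ 2)
  set s := Real.sqrt (n * (n - 1))
  obtain ⟨a, ha⟩ : ∃ a, a = r / s := ⟨_, rfl⟩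
  have hra : r = a * s := by rw [ha, div_mul_cancel₀ _ hs.ne']
  have ha0 : 0 ≤ a := ha ▸ div_nonneg hr hs.le
  have hS2 : ∑ i, x i ^ 2 = a ^ 2 * (n * (n - 1)) := by rw [← hr2, hra, mul_pow, hs2]
  have hmax (i : ι) : x i ≤ (n - 1) * a := by
    refine (abs_le_of_sq_le_sq' ?_ (mul_nonneg (by linarith) ha0)).2
    have h := hle i
    rw [hS2] at h
    refine le_of_mul_le_mul_left (h.trans_eq ?_) (by linarith : 0 < n)
    ring
  have hsum : ∑ i, (x i - (n - 1) * a) * (x i + a) ^ 2 ≤ 0 :=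
    Finset.sum_nonpos fun i _ =>
      mul_nonpos_of_nonpos_of_nonneg (sub_nonpos.mpr (hmax i)) (sq_nonneg _)
  have hexp : ∑ i, (x i - (n - 1) * a) * (x i + a) ^ 2 =
      ∑ i, x i ^ 3 + (3 - n) * a * ∑ i, x i ^ 2 + (3 - 2 * n) * a ^ 2 * ∑ i, x i -
        (n - 1) * a ^ 3 * ∑ _i : ι, (1 : ℝ) := by
    simp only [Finset.mul_sum, ← Finset.sum_add_distrib, ← Finset.sum_sub_distrib]
    exact Finset.sum_congr rfl fun i _ => by ring
  have hrhs : (n - 2) / s * r ^ 3 = (n - 2) * a ^ 3 * (n * (n - 1)) := by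
    rw [← hs2, hra]
    field_simp
  rw [hexp, hx, hS2, hcard] at hsum
  rw [hrhs]
  linarith

/-- Huisken's trace-of-cube estimate for trace-free symmetric matrices:
if `T` is a real symmetric `n × n` matrix with `tr T = 0` and `n ≥ 2`, then
`tr (T³) ≤ ((n-2)/√(n(n-1))) ‖T‖³` with `‖·‖` the Frobenius norm. -/
theorem stmt_0 (n : ℕ) (hn : 2 ≤ n) (T : Matrix (Fin n) (Fin n) ℝ)
    (hsymm : T.IsSymm) (htr : T.trace = 0) :
    (T * T * T).trace ≤
      (((n : ℝ) - 2) / Real.sqrt ((n : ℝ) * ((n : ℝ) - 1))) *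
        Real.sqrt (∑ i, ∑ j, T i j ^ 2) ^ 3 := by
  have hA : T.IsHermitian := by
    rw [Matrix.IsHermitian, Matrix.conjTranspose_eq_transpose_of_trivial]
    exact hsymm
  have h1 : ∑ i, hA.eigenvalues i = 0 := by
    simpa [htr] using (trace_pow_eq_sum_eigenvalues_pow hA 1).symm
  have h2 : ∑ i, ∑ j, T i j ^ 2 = ∑ i, hA.eigenvalues i ^ 2 := by
    rw [← trace_pow_eq_sum_eigenvalues_pow hA 2, pow_two, Matrix.trace]
    refine Finset.sum_congr rfl fun i _ => ?_
    rw [Matrix.diag_apply, Matrix.mul_apply]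
    refine Finset.sum_congr rfl fun j _ => ?_
    rw [hsymm.apply i j, pow_two]
  have h3 : (T * T * T).trace = ∑ i, hA.eigenvalues i ^ 3 := by
    rw [← trace_pow_eq_sum_eigenvalues_pow hA 3, pow_succ, pow_two]
  rw [h2, h3]
  simpa using sum_pow_three_le_of_sum_eq_zero hA.eigenvalues h1 (by simpa using hn)
end

section
/- Let n ≥ 1, let T be any 4-tensor on ℝⁿ (a family of reals T_{ijkl}, i,j,k,l ∈ {1,…,n}), and let B be a real symmetric n×n matrix with tr(B) = 0. Then |Σ_{i,j,k,l,h} T_{ijkl} T_{ijkh} B_{hl}| ≤ √((n−1)/n) · ‖B‖ · ‖T‖², where ‖T‖² = Σ_{i,j,k,l} T_{ijkl}² and ‖B‖ is the Frobenius norm of B. -/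
/-- For a trace-free matrix `B`, the quadratic form of `B` is the Frobenius pairing of `B` with the
trace-free part of `v vᵀ`, so Cauchy-Schwarz bounds it by `√((n-1)/n) ‖B‖ ‖v‖²`. -/
theorem abs_quadraticForm_le_of_trace_eq_zero {ι : Type*} [Fintype ι] [Nonempty ι]
    (B : Matrix ι ι ℝ) (htr : B.trace = 0) (v : ι → ℝ) :
    |∑ l, ∑ h, v l * v h * B h l| ≤
      Real.sqrt (((Fintype.card ι : ℝ) - 1) / Fintype.card ι) *
        Real.sqrt (∑ i, ∑ j, B i j ^ 2) * ∑ l, v l ^ 2 := by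
  classical
  set n : ℝ := (Fintype.card ι : ℝ) with hn_def
  have hn : 1 ≤ n := by
    rw [hn_def]
    exact_mod_cast Fintype.card_pos (α := ι)
  set s := ∑ l, v l ^ 2 with hs
  have hs0 : 0 ≤ s := Finset.sum_nonneg fun _ _ => sq_nonneg _
  let C : ι → ι → ℝ := fun h l => v l * v h - if h = l then s / n else 0
  have hpair : ∑ h, ∑ l, C h l * B h l = ∑ l, ∑ h, v l * v h * B h l := by
    have htr' : ∑ i, B i i = 0 := htr
    rw [Finset.sum_comm (f := fun l h => v l * v h * B h l)]
    simp [C, sub_mul, Finset.sum_sub_distrib, ite_mul, ← Finset.mul_sum, htr']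
  have hnorm : ∑ h, ∑ l, C h l ^ 2 = (n - 1) / n * s ^ 2 := by
    have hexp : ∀ h l, C h l ^ 2 = v h ^ 2 * v l ^ 2 -
        (if h = l then 2 * (s / n) * v h ^ 2 - (s / n) ^ 2 else 0) := by
      intro h l
      by_cases hl : h = l
      · subst hl
        simp only [C, if_true]
        ring
      · simp only [C, hl, if_false]
        ring
    simp only [hexp, Finset.sum_sub_distrib, Finset.sum_ite_eq, Finset.mem_univ, if_true,
      ← Finset.mul_sum, ← Finset.sum_mul, ← hs, Finset.sum_const, Finset.card_univ, nsmul_eq_mul,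
      ← hn_def]
    field_simp
    ring
  have hcs : (∑ l, ∑ h, v l * v h * B h l) ^ 2 ≤
      ((n - 1) / n * s ^ 2) * ∑ i, ∑ j, B i j ^ 2 := by
    rw [← hpair, ← hnorm]
    simp only [← Fintype.sum_prod_type']
    exact Finset.sum_mul_sq_le_sq_mul_sq _ _ _
  apply abs_le_of_sq_le_sq _ (by positivity)
  rw [mul_pow, mul_pow, Real.sq_sqrt (div_nonneg (by linarith) (by linarith)),
    Real.sq_sqrt (by positivity)]
  linarith


/-- Inequality (2.12): for any 4-tensor `T` on `ℝⁿ` and any real symmetric trace-free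
`n × n` matrix `B`,
`|∑ T_{ijkl} T_{ijkh} B_{hl}| ≤ √((n-1)/n) ‖B‖ ‖T‖²`. -/
theorem stmt_3 (n : ℕ) (hn : 1 ≤ n) (T : Fin n → Fin n → Fin n → Fin n → ℝ)
    (B : Matrix (Fin n) (Fin n) ℝ) (hB : B.IsSymm) (htr : B.trace = 0) :
    |∑ i, ∑ j, ∑ k, ∑ l, ∑ h, T i j k l * T i j k h * B h l| ≤
      Real.sqrt (((n : ℝ) - 1) / n) * Real.sqrt (∑ i, ∑ j, B i j ^ 2) *
        (∑ i, ∑ j, ∑ k, ∑ l, T i j k l ^ 2) := by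
  have : Nonempty (Fin n) := ⟨⟨0, hn⟩⟩
  rw [Finset.mul_sum]
  refine (Finset.abs_sum_le_sum_abs _ _).trans (Finset.sum_le_sum fun i _ => ?_)
  rw [Finset.mul_sum]
  refine (Finset.abs_sum_le_sum_abs _ _).trans (Finset.sum_le_sum fun j _ => ?_)
  rw [Finset.mul_sum]
  refine (Finset.abs_sum_le_sum_abs _ _).trans (Finset.sum_le_sum fun k _ => ?_)
  simpa using abs_quadraticForm_le_of_trace_eq_zero B htr (T i j k)
end

section
/- Let n ≥ 3 and let B be a real symmetric n×n matrix with tr(B) = 0. Define, with ∧ the Kulkarni–Nomizu product and g the identity matrix, the 4-tensors V' = −(2/(n−2)) (B²∧g) + (2/(n(n−2))) ‖B‖² (g∧g), U' = −(1/(n(n−1))) ‖B‖² (g∧g), and T = B∧B − V' − U'. Then: (i) T is totally trace-free (Σ_i T_{ijil} = 0 for all j,l); (ii) ‖B∧B‖² = 8‖B‖⁴ − 8‖B²‖²; (iii) ‖V'‖² = (16/(n−2))‖B²‖² − (16/(n(n−2)))‖B‖⁴; (iv) ‖U'‖² = (8/(n(n−1)))‖B‖⁴; and (v) ‖T‖²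 + (n/2)‖V'‖² = (8(n−2)/(n−1))‖B‖⁴. -/
/-- The Kulkarni–Nomizu product of two `n × n` matrices, as a 4-tensor on `ℝⁿ`. -/
def kulkarniNomizu {n : ℕ} (A B : Matrix (Fin n) (Fin n) ℝ) :
    Fin n → Fin n → Fin n → Fin n → ℝ :=
  fun i j k l => A i k * B j l - A i l * B j k + A j l * B i k - A j k * B i l

/-- The trace of the Kulkarni–Nomizu product over the first and third index. -/
theorem sum_kulkarniNomizu {n : ℕ} (A C : Matrix (Fin n) (Fin n) ℝ)
    (j l : Fin n) :
    ∑ i, kulkarniNomizu A C i j i l =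
      A.trace * C j l + C.trace * A j l - (C * A) j l - (A * C) j l := by
  simp only [kulkarniNomizu, Matrix.trace, Matrix.diag, Matrix.mul_apply, Finset.sum_sub_distrib,
    Finset.sum_add_distrib, Finset.sum_mul]
  simp only [mul_comm]
  ring

/-- Pairing with a Kulkarni–Nomizu product reduces to pairing with `A i k * C j l` when the other
factor is antisymmetric in each pair of indices. -/
theorem sum_kulkarniNomizu_mul_of_antisymm {n : ℕ} (A C : Matrix (Fin n) (Fin n) ℝ)
    (S : Fin n → Fin n → Fin n → Fin n → ℝ) (h₁ : ∀ i j k l, S j i k l = -S i j k l)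
    (h₂ : ∀ i j k l, S i j l k = -S i j k l) :
    ∑ i, ∑ j, ∑ k, ∑ l, kulkarniNomizu A C i j k l * S i j k l =
      4 * ∑ i, ∑ j, ∑ k, ∑ l, A i k * C j l * S i j k l := by
  have e₁ : ∑ i, ∑ j, ∑ k, ∑ l, A i l * C j k * S i j k l =
      -∑ i, ∑ j, ∑ k, ∑ l, A i k * C j l * S i j k l := by
    simp only [← Finset.sum_neg_distrib]
    refine Finset.sum_congr rfl fun i _ => Finset.sum_congr rfl fun j _ => ?_
    rw [Finset.sum_comm]
    refine Finset.sum_congr rfl fun k _ => Finset.sum_congr rfl fun l _ => ?_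
    rw [h₂]; ring
  have e₂ : ∑ i, ∑ j, ∑ k, ∑ l, A j k * C i l * S i j k l =
      -∑ i, ∑ j, ∑ k, ∑ l, A i k * C j l * S i j k l := by
    rw [Finset.sum_comm]
    simp only [← Finset.sum_neg_distrib]
    refine Finset.sum_congr rfl fun i _ => Finset.sum_congr rfl fun j _ =>
      Finset.sum_congr rfl fun k _ => Finset.sum_congr rfl fun l _ => ?_
    rw [h₁]; ring
  have e₃ : ∑ i, ∑ j, ∑ k, ∑ l, A j l * C i k * S i j k l =
      ∑ i, ∑ j, ∑ k, ∑ l, A i k * C j l * S i j k l := by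
    rw [Finset.sum_comm]
    refine Finset.sum_congr rfl fun i _ => Finset.sum_congr rfl fun j _ => ?_
    rw [Finset.sum_comm]
    refine Finset.sum_congr rfl fun k _ => Finset.sum_congr rfl fun l _ => ?_
    rw [h₁, h₂]; ring
  have e : ∀ i j k l, kulkarniNomizu A C i j k l * S i j k l = A i k * C j l * S i j k l -
      A i l * C j k * S i j k l + A j l * C i k * S i j k l - A j k * C i l * S i j k l := by
    intro i j k l
    simp only [kulkarniNomizu]; ring
  simp only [e, Finset.sum_sub_distrib, Finset.sum_add_distrib, e₁, e₂, e₃]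
  ring

theorem sum_mul_mul_mul_eq_trace_mul_trace {n : ℕ} (A C E F : Matrix (Fin n) (Fin n) ℝ)
    (hE : E.IsSymm) (hF : F.IsSymm) :
    ∑ i, ∑ j, ∑ k, ∑ l, A i k * C j l * (E i k * F j l) =
      (A * E).trace * (C * F).trace := by
  simp only [Matrix.trace, Matrix.diag, Matrix.mul_apply, Finset.sum_mul_sum]
  refine Finset.sum_congr rfl fun i _ => Finset.sum_congr rfl fun j _ =>
    Finset.sum_congr rfl fun k _ => Finset.sum_congr rfl fun l _ => ?_
  rw [hE.apply i k, hF.apply j l]; ring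

theorem sum_mul_mul_mul_eq_trace {n : ℕ} (A C E F : Matrix (Fin n) (Fin n) ℝ)
    (hE : E.IsSymm) (hF : F.IsSymm) :
    ∑ i, ∑ j, ∑ k, ∑ l, A i k * C j l * (E i l * F j k) = (A * F * (C * E)).trace := by
  simp only [Matrix.trace, Matrix.diag, Matrix.mul_apply, Finset.sum_mul_sum]
  refine Finset.sum_congr rfl fun i _ => Finset.sum_congr rfl fun j _ =>
    Finset.sum_congr rfl fun k _ => Finset.sum_congr rfl fun l _ => ?_
  rw [hE.apply i l, hF.apply k j]; ring

/-- The inner product of two Kulkarni–Nomizu products. -/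
theorem sum_kulkarniNomizu_mul_kulkarniNomizu {n : ℕ} (A C E F : Matrix (Fin n) (Fin n) ℝ)
    (hE : E.IsSymm) (hF : F.IsSymm) :
    ∑ i, ∑ j, ∑ k, ∑ l, kulkarniNomizu A C i j k l * kulkarniNomizu E F i j k l =
      4 * ((A * E).trace * (C * F).trace + (A * F).trace * (C * E).trace -
        (A * F * (C * E)).trace - (A * E * (C * F)).trace) := by
  rw [sum_kulkarniNomizu_mul_of_antisymm A C _
    (fun i j k l => by simp only [kulkarniNomizu]; ring)
    (fun i j k l => by simp only [kulkarniNomizu]; ring),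
    ← sum_mul_mul_mul_eq_trace_mul_trace A C E F hE hF,
    ← sum_mul_mul_mul_eq_trace_mul_trace A C F E hF hE,
    ← sum_mul_mul_mul_eq_trace A C E F hE hF, ← sum_mul_mul_mul_eq_trace A C F E hF hE]
  simp only [← Finset.sum_sub_distrib, ← Finset.sum_add_distrib]
  congr 1
  refine Finset.sum_congr rfl fun i _ => Finset.sum_congr rfl fun j _ =>
    Finset.sum_congr rfl fun k _ => Finset.sum_congr rfl fun l _ => ?_
  simp only [kulkarniNomizu]; ring

theorem Matrix.IsSymm.sum_sq_eq_trace {n : ℕ} {A : Matrix (Fin n) (Fin n) ℝ} (hA : A.IsSymm) :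
    ∑ i, ∑ j, A i j ^ 2 = (A * A).trace := by
  simp only [Matrix.trace, Matrix.diag, Matrix.mul_apply]
  refine Finset.sum_congr rfl fun i _ => Finset.sum_congr rfl fun j _ => ?_
  rw [hA.apply i j, sq]

/-- The squared norm of a linear combination of three 4-tensors. -/
theorem sum_linear_combination_sq {n : ℕ} (P Q R : Fin n → Fin n → Fin n → Fin n → ℝ)
    (a b c : ℝ) :
    ∑ i, ∑ j, ∑ k, ∑ l, (a * P i j k l + b * Q i j k l + c * R i j k l) ^ 2 =
      a ^ 2 * (∑ i, ∑ j, ∑ k, ∑ l, P i j k l * P i j k l) +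
      b ^ 2 * (∑ i, ∑ j, ∑ k, ∑ l, Q i j k l * Q i j k l) +
      c ^ 2 * (∑ i, ∑ j, ∑ k, ∑ l, R i j k l * R i j k l) +
      2 * a * b * (∑ i, ∑ j, ∑ k, ∑ l, P i j k l * Q i j k l) +
      2 * a * c * (∑ i, ∑ j, ∑ k, ∑ l, P i j k l * R i j k l) +
      2 * b * c * (∑ i, ∑ j, ∑ k, ∑ l, Q i j k l * R i j k l) := by
  simp only [Finset.mul_sum, ← Finset.sum_add_distrib]
  refine Finset.sum_congr rfl fun i _ => Finset.sum_congr rfl fun j _ =>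
    Finset.sum_congr rfl fun k _ => Finset.sum_congr rfl fun l _ => ?_
  ring

/-- The orthogonal decomposition `B ∧ B = T + V' + U'` and the norm computations from the
proof of Lemma 3.3: `T` is totally trace-free, `‖B∧B‖² = 8‖B‖⁴ - 8‖B²‖²`,
`‖V'‖² = (16/(n-2))‖B²‖² - (16/(n(n-2)))‖B‖⁴`, `‖U'‖² = (8/(n(n-1)))‖B‖⁴`, and
`‖T‖² + (n/2)‖V'‖² = (8(n-2)/(n-1))‖B‖⁴`. -/
theorem stmt_7 (n : ℕ) (hn : 3 ≤ n) (B : Matrix (Fin n) (Fin n) ℝ)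
    (hB : B.IsSymm) (htr : B.trace = 0)
    (V' U' T : Fin n → Fin n → Fin n → Fin n → ℝ)
    (hV' : ∀ i j k l, V' i j k l =
      -(2 / ((n : ℝ) - 2)) * kulkarniNomizu (B * B) 1 i j k l +
        (2 / ((n : ℝ) * ((n : ℝ) - 2))) * (∑ i', ∑ j', B i' j' ^ 2) *
          kulkarniNomizu 1 1 i j k l)
    (hU' : ∀ i j k l, U' i j k l =
      -(1 / ((n : ℝ) * ((n : ℝ) - 1))) * (∑ i', ∑ j', B i' j' ^ 2) *
        kulkarniNomizu 1 1 i j k l)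
    (hT : ∀ i j k l, T i j k l = kulkarniNomizu B B i j k l - V' i j k l - U' i j k l) :
    (∀ j l, ∑ i, T i j i l = 0) ∧
      (∑ i, ∑ j, ∑ k, ∑ l, kulkarniNomizu B B i j k l ^ 2) =
        8 * (∑ i, ∑ j, B i j ^ 2) ^ 2 - 8 * (∑ i, ∑ j, (B * B) i j ^ 2) ∧
      (∑ i, ∑ j, ∑ k, ∑ l, V' i j k l ^ 2) =
        (16 / ((n : ℝ) - 2)) * (∑ i, ∑ j, (B * B) i j ^ 2) -
          (16 / ((n : ℝ) * ((n : ℝ) - 2))) * (∑ i, ∑ j, B i j ^ 2) ^ 2 ∧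
      (∑ i, ∑ j, ∑ k, ∑ l, U' i j k l ^ 2) =
        (8 / ((n : ℝ) * ((n : ℝ) - 1))) * (∑ i, ∑ j, B i j ^ 2) ^ 2 ∧
      (∑ i, ∑ j, ∑ k, ∑ l, T i j k l ^ 2) +
          ((n : ℝ) / 2) * (∑ i, ∑ j, ∑ k, ∑ l, V' i j k l ^ 2) =
        (8 * ((n : ℝ) - 2) / ((n : ℝ) - 1)) * (∑ i, ∑ j, B i j ^ 2) ^ 2 := by
  have hn' : (3 : ℝ) ≤ n := by exact_mod_cast hn
  have h0 : (n : ℝ) ≠ 0 := by linarith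
  have h1 : (n : ℝ) - 1 ≠ 0 := by linarith
  have h2 : (n : ℝ) - 2 ≠ 0 := by linarith
  have hBB : (B * B).IsSymm := by
    rw [Matrix.IsSymm, Matrix.transpose_mul, hB.eq]
  have h_one : (1 : Matrix (Fin n) (Fin n) ℝ).IsSymm := Matrix.isSymm_one
  simp only [hB.sum_sq_eq_trace, hBB.sum_sq_eq_trace] at hV' hU' ⊢
  set s := (B * B).trace with hs
  set q := (B * B * (B * B)).trace with hq
  have c (a b c : ℝ) := sum_linear_combination_sq (kulkarniNomizu B B) (kulkarniNomizu (B * B) 1)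
    (kulkarniNomizu 1 1) a b c
  simp only [sum_kulkarniNomizu_mul_kulkarniNomizu _ _ _ _ hB hB,
    sum_kulkarniNomizu_mul_kulkarniNomizu _ _ _ _ hBB h_one,
    sum_kulkarniNomizu_mul_kulkarniNomizu _ _ _ _ h_one h_one, Matrix.mul_one, Matrix.one_mul,
    Matrix.trace_one, Fintype.card_fin, htr, ← Matrix.mul_assoc] at c
  simp only [← Matrix.mul_assoc] at hq
  simp only [← hs, ← hq] at c
  refine ⟨fun j l => ?_, ?_, ?_, ?_, ?_⟩
  · simp only [hT, hV', hU', Finset.sum_sub_distrib, Finset.sum_add_distrib, ← Finset.mul_sum,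
      sum_kulkarniNomizu, htr, Matrix.mul_one, Matrix.one_mul, Matrix.trace_one, Fintype.card_fin,
      ← hs]
    field_simp
    ring
  · have := c 1 0 0
    simp only [one_mul, zero_mul, add_zero] at this
    rw [this]
    ring
  · have := c 0 (-(2 / ((n : ℝ) - 2))) (2 / ((n : ℝ) * ((n : ℝ) - 2)) * s)
    simp only [zero_mul, zero_add] at this
    simp only [hV']
    rw [this]
    field_simp
    ring
  · have := c 0 0 (-(1 / ((n : ℝ) * ((n : ℝ) - 1))) * s)
    simp only [zero_mul, zero_add] at this
    simp only [hU']
    rw [this]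
    field_simp
    ring
  · have hv := c 0 (-(2 / ((n : ℝ) - 2))) (2 / ((n : ℝ) * ((n : ℝ) - 2)) * s)
    simp only [zero_mul, zero_add] at hv
    have ht := c 1 (2 / ((n : ℝ) - 2))
      (-(2 / ((n : ℝ) * ((n : ℝ) - 2)) * s) + 1 / ((n : ℝ) * ((n : ℝ) - 1)) * s)
    have e : ∀ i j k l, T i j k l = 1 * kulkarniNomizu B B i j k l +
        2 / ((n : ℝ) - 2) * kulkarniNomizu (B * B) 1 i j k l +
        (-(2 / ((n : ℝ) * ((n : ℝ) - 2)) * s) + 1 / ((n : ℝ) * ((n : ℝ) - 1)) * s) *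
          kulkarniNomizu 1 1 i j k l := by
      intro i j k l
      rw [hT, hV', hU']
      ring
    simp only [e, hV']
    rw [hv, ht]
    field_simp
    ring
end

section
/- (Remark 3.4) Let n ≥ 3, let K be a real constant, let W be a 4-tensor on ℝⁿ with the algebraic symmetries of the Riemann curvature tensor (W_{ijkl} = W_{klij} = −W_{jikl} = −W_{ijlk}) which is totally trace-free (Σ_i W_{ijil} = 0 for all j,l), and let B be a real symmetric n×n matrix with tr(B) = 0. Then | −Σ_{i,j,k,l} W_{ijkl} B_{ik} B_{jl} + K · tr(B³) | ≤ √((n−2)/(2(n−1))) · ‖B‖² · ( ‖W‖² + (2(n−2)K²/n) ‖B‖² )^{1/2}. -/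
/-- The tensor `(B ∧ B) + (C ∧ g)`, with `g` the Euclidean metric: the general form of the
curvature-type tensors used to split off the traces of `B ∧ B`. -/
def wedgeTensor {n : ℕ} (B C : Matrix (Fin n) (Fin n) ℝ) (i j k l : Fin n) : ℝ :=
  B i k * B j l - B i l * B j k +
    (C i k * (1 : Matrix (Fin n) (Fin n) ℝ) j l + C j l * (1 : Matrix (Fin n) (Fin n) ℝ) i k
      - C i l * (1 : Matrix (Fin n) (Fin n) ℝ) j k - C j k * (1 : Matrix (Fin n) (Fin n) ℝ) i l)

lemma wedgeTensor_swap_left {n : ℕ} (B C : Matrix (Fin n) (Fin n) ℝ) (i j k l : Fin n) :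
    wedgeTensor B C i j k l = -wedgeTensor B C j i k l := by
  unfold wedgeTensor; ring

lemma wedgeTensor_swap_right {n : ℕ} (B C : Matrix (Fin n) (Fin n) ℝ) (i j k l : Fin n) :
    wedgeTensor B C i j k l = -wedgeTensor B C i j l k := by
  unfold wedgeTensor; ring

lemma wedgeTensor_trace {n : ℕ} (B C : Matrix (Fin n) (Fin n) ℝ) (j l : Fin n) :
    ∑ i, wedgeTensor B C i j i l =
      B.trace * B j l - (B * B) j l + ((n - 2) * C j l + C.trace * (1 : Matrix _ _ ℝ) j l) := by
  have h : ∑ i, B i l * B j i = (B * B) j l := by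
    simp only [Matrix.mul_apply, mul_comm]
  simp only [wedgeTensor, Finset.sum_add_distrib, Finset.sum_sub_distrib, h,
    ← Finset.sum_mul, Matrix.trace, Matrix.diag]
  simp [Matrix.one_apply]
  ring

/-- A totally trace-free tensor which is antisymmetric in both pairs of indices only sees the
`B ⊗ B` part of `wedgeTensor B C`. -/
lemma sum_mul_wedgeTensor {n : ℕ} (X : Fin n → Fin n → Fin n → Fin n → ℝ)
    (h1 : ∀ i j k l, X i j k l = -X j i k l) (h2 : ∀ i j k l, X i j k l = -X i j l k)
    (h0 : ∀ j l, ∑ i, X i j i l = 0) (B C : Matrix (Fin n) (Fin n) ℝ) :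
    ∑ i, ∑ j, ∑ k, ∑ l, X i j k l * wedgeTensor B C i j k l =
      2 * ∑ i, ∑ j, ∑ k, ∑ l, X i j k l * B i k * B j l := by
  have h0' : ∀ i k, ∑ j, X i j k j = 0 := fun i k => by
    rw [← h0 i k]
    exact Finset.sum_congr rfl fun j _ => by rw [h1, h2, neg_neg]
  have h0l : ∀ i l, ∑ j, X i j j l = 0 := fun i l => by
    rw [← neg_eq_zero, ← Finset.sum_neg_distrib, ← h0 i l]
    exact Finset.sum_congr rfl fun j _ => by rw [h1, neg_neg]
  have h0r : ∀ j k, ∑ i, X i j k i = 0 := fun j k => by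
    rw [← neg_eq_zero, ← Finset.sum_neg_distrib, ← h0 j k]
    exact Finset.sum_congr rfl fun i _ => by rw [h2, neg_neg]
  have hswap : ∑ i, ∑ j, ∑ k, ∑ l, X i j k l * (B i l * B j k) =
      -∑ i, ∑ j, ∑ k, ∑ l, X i j k l * (B i k * B j l) := by
    simp only [← Finset.sum_neg_distrib]
    refine Finset.sum_congr rfl fun i _ => Finset.sum_congr rfl fun j _ => ?_
    rw [Finset.sum_comm]
    exact Finset.sum_congr rfl fun k _ => Finset.sum_congr rfl fun l _ => by
      rw [h2 i j l k, neg_mul]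
  have e1 : ∑ i, ∑ j, ∑ k, ∑ l, X i j k l * (C i k * (1 : Matrix _ _ ℝ) j l) = 0 := by
    refine Finset.sum_eq_zero fun i _ => ?_
    rw [Finset.sum_comm]
    refine Finset.sum_eq_zero fun k _ => ?_
    simp [Matrix.one_apply, ← Finset.sum_mul, h0']
  have e2 : ∑ i, ∑ j, ∑ k, ∑ l, X i j k l * (C j l * (1 : Matrix _ _ ℝ) i k) = 0 := by
    rw [Finset.sum_comm]
    refine Finset.sum_eq_zero fun j _ => ?_
    simp only [Matrix.one_apply, mul_ite, mul_one, mul_zero]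
    simp_rw [fun i => Finset.sum_comm (s := Finset.univ) (t := Finset.univ)
      (f := fun k l => if i = k then X i j k l * C j l else 0)]
    rw [Finset.sum_comm]
    simp [← Finset.sum_mul, h0]
  have e3 : ∑ i, ∑ j, ∑ k, ∑ l, X i j k l * (C i l * (1 : Matrix _ _ ℝ) j k) = 0 := by
    refine Finset.sum_eq_zero fun i _ => ?_
    simp only [Matrix.one_apply, mul_ite, mul_one, mul_zero]
    simp_rw [fun j => Finset.sum_comm (s := Finset.univ) (t := Finset.univ)
      (f := fun k l => if j = k then X i j k l * C i l else 0)]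
    rw [Finset.sum_comm]
    simp [← Finset.sum_mul, h0l]
  have e4 : ∑ i, ∑ j, ∑ k, ∑ l, X i j k l * (C j k * (1 : Matrix _ _ ℝ) i l) = 0 := by
    rw [Finset.sum_comm]
    refine Finset.sum_eq_zero fun j _ => ?_
    rw [Finset.sum_comm]
    refine Finset.sum_eq_zero fun k _ => ?_
    simp [Matrix.one_apply, ← Finset.sum_mul, h0r]
  simp only [wedgeTensor, mul_add, mul_sub, Finset.sum_add_distrib, Finset.sum_sub_distrib,
    hswap, e1, e2, e3, e4, mul_assoc]
  ring

lemma trace_mul_self_eq_sum_sq {n : ℕ} {A : Matrix (Fin n) (Fin n) ℝ} (hA : A.IsSymm) :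
    (A * A).trace = ∑ i, ∑ j, A i j ^ 2 := by
  simp only [Matrix.trace, Matrix.diag, Matrix.mul_apply]
  exact Finset.sum_congr rfl fun i _ => Finset.sum_congr rfl fun j _ => by
    rw [hA.apply i j, sq]

lemma sum_wedgeTensor_mul {n : ℕ} {B C : Matrix (Fin n) (Fin n) ℝ} (hB : B.IsSymm)
    (htr : B.trace = 0) :
    ∑ i, ∑ j, ∑ k, ∑ l, wedgeTensor B C i j k l * B i k * B j l =
      (B * B).trace ^ 2 - (B * B * (B * B)).trace - 2 * (C * (B * B)).trace := by
  have e0 : ∑ i, ∑ j, ∑ k, ∑ l, B i k * B j l * (B i k * B j l) = (B * B).trace ^ 2 := by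
    rw [trace_mul_self_eq_sum_sq hB, sq, Finset.sum_mul_sum]
    simp only [Finset.sum_mul_sum]
    exact Finset.sum_congr rfl fun i _ => Finset.sum_congr rfl fun j _ =>
      Finset.sum_congr rfl fun k _ => Finset.sum_congr rfl fun l _ => by ring
  have e1 : ∑ i, ∑ j, ∑ k, ∑ l, B i l * B j k * (B i k * B j l) =
      (B * B * (B * B)).trace := by
    simp only [Matrix.trace, Matrix.diag, Matrix.mul_apply, Finset.sum_mul_sum]
    exact Finset.sum_congr rfl fun i _ => Finset.sum_congr rfl fun j _ =>
      Finset.sum_congr rfl fun k _ => Finset.sum_congr rfl fun l _ => by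
        rw [hB.apply j k, hB.apply i l]; ring
  have h0 : ∑ j, B j j = 0 := htr
  have e2 : ∑ i, ∑ j, ∑ k, ∑ l, C i k * (1 : Matrix _ _ ℝ) j l * (B i k * B j l) = 0 := by
    refine Finset.sum_eq_zero fun i _ => ?_
    rw [Finset.sum_comm]
    refine Finset.sum_eq_zero fun k _ => ?_
    simp [Matrix.one_apply, ← Finset.mul_sum, h0]
  have e3 : ∑ i, ∑ j, ∑ k, ∑ l, C j l * (1 : Matrix _ _ ℝ) i k * (B i k * B j l) = 0 := by
    rw [Finset.sum_comm, ← e2]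
    exact Finset.sum_congr rfl fun j _ => Finset.sum_congr rfl fun i _ => by
      rw [Finset.sum_comm]
      exact Finset.sum_congr rfl fun l _ => Finset.sum_congr rfl fun k _ => by ring
  have e4 : ∑ i, ∑ j, ∑ k, ∑ l, C i l * (1 : Matrix _ _ ℝ) j k * (B i k * B j l) =
      (C * (B * B)).trace := by
    simp only [Matrix.trace, Matrix.diag, Matrix.mul_apply, Finset.mul_sum]
    refine Finset.sum_congr rfl fun i _ => ?_
    rw [Finset.sum_comm (f := fun a b => C i a * (B a b * B b i))]
    refine Finset.sum_congr rfl fun j _ => ?_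
    rw [Finset.sum_comm]
    refine Finset.sum_congr rfl fun l _ => ?_
    simp [Matrix.one_apply]
    rw [hB.apply i j, hB.apply j l]
    exact Or.inl (mul_comm _ _)
  have e5 : ∑ i, ∑ j, ∑ k, ∑ l, C j k * (1 : Matrix _ _ ℝ) i l * (B i k * B j l) =
      (C * (B * B)).trace := by
    rw [Finset.sum_comm, ← e4]
    exact Finset.sum_congr rfl fun j _ => Finset.sum_congr rfl fun i _ => by
      rw [Finset.sum_comm]
      exact Finset.sum_congr rfl fun l _ => Finset.sum_congr rfl fun k _ => by ring
  simp only [wedgeTensor, mul_assoc, add_mul, sub_mul, Finset.sum_add_distrib,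
    Finset.sum_sub_distrib] at e0 e1 e2 e3 e4 e5 ⊢
  rw [e0, e1, e2, e3, e4, e5]
  ring

/-- The totally trace-free part of `B ∧ B` is of the form `wedgeTensor B C`. -/
lemma exists_wedgeTensor_traceFree {n : ℕ} (hn : 3 ≤ n) {B : Matrix (Fin n) (Fin n) ℝ}
    (hB : B.IsSymm) (htr : B.trace = 0) :
    ∃ C : Matrix (Fin n) (Fin n) ℝ, (∀ j l, ∑ i, wedgeTensor B C i j i l = 0) ∧
      ∑ i, ∑ j, ∑ k, ∑ l, wedgeTensor B C i j k l ^ 2 =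
        2 * (B * B).trace ^ 2 - 2 * (B * B * (B * B)).trace
          - 4 / (n - 2) * (B * B * (B * B)).trace
          + 2 / ((n - 1) * (n - 2)) * (B * B).trace ^ 2 := by
  have hn' : (3 : ℝ) ≤ n := by exact_mod_cast hn
  have hn1 : (n : ℝ) - 1 ≠ 0 := by linarith
  have hn2 : (n : ℝ) - 2 ≠ 0 := by linarith
  obtain ⟨c, hc⟩ : ∃ c : ℝ, c = -(B * B).trace / (2 * (n - 1) * (n - 2)) := ⟨_, rfl⟩
  obtain ⟨C, hC⟩ : ∃ C : Matrix (Fin n) (Fin n) ℝ,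
    C = ((n : ℝ) - 2)⁻¹ • (B * B) + c • 1 := ⟨_, rfl⟩
  have hCtr : C.trace = -((n : ℝ) - 2) * c := by
    simp only [hC, Matrix.trace_add, Matrix.trace_smul, Matrix.trace_one, smul_eq_mul,
      Fintype.card_fin, hc]
    field_simp
    ring
  have hV0 : ∀ j l, ∑ i, wedgeTensor B C i j i l = 0 := fun j l => by
    rw [wedgeTensor_trace B C, htr, hCtr]
    simp only [hC, Matrix.add_apply, Matrix.smul_apply, smul_eq_mul]
    field_simp
    ring
  have hCA : (C * (B * B)).trace =
      ((n : ℝ) - 2)⁻¹ * (B * B * (B * B)).trace + c * (B * B).trace := by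
    simp [hC, add_mul]
  refine ⟨C, hV0, ?_⟩
  simp only [sq (wedgeTensor B C _ _ _ _)]
  rw [sum_mul_wedgeTensor _ (wedgeTensor_swap_left B C) (wedgeTensor_swap_right B C) hV0,
    sum_wedgeTensor_mul hB htr, hCA, hc]
  field_simp
  ring

/-- Cauchy–Schwarz against the totally trace-free part of `B ∧ B`. -/
lemma sq_sum_weyl_le {n : ℕ} (hn : 3 ≤ n) (W : Fin n → Fin n → Fin n → Fin n → ℝ)
    (hanti1 : ∀ i j k l, W i j k l = -W j i k l)
    (hanti2 : ∀ i j k l, W i j k l = -W i j l k)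
    (htracefree : ∀ j l, ∑ i, W i j i l = 0)
    {B : Matrix (Fin n) (Fin n) ℝ} (hB : B.IsSymm) (htr : B.trace = 0) :
    0 ≤ 2 * (B * B).trace ^ 2 - 2 * (B * B * (B * B)).trace
          - 4 / (n - 2) * (B * B * (B * B)).trace
          + 2 / ((n - 1) * (n - 2)) * (B * B).trace ^ 2 ∧
    4 * (∑ i, ∑ j, ∑ k, ∑ l, W i j k l * B i k * B j l) ^ 2 ≤
      (∑ i, ∑ j, ∑ k, ∑ l, W i j k l ^ 2) *
        (2 * (B * B).trace ^ 2 - 2 * (B * B * (B * B)).trace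
          - 4 / (n - 2) * (B * B * (B * B)).trace
          + 2 / ((n - 1) * (n - 2)) * (B * B).trace ^ 2) := by
  obtain ⟨C, hV0, hVV⟩ := exists_wedgeTensor_traceFree hn hB htr
  have hcs := Finset.sum_mul_sq_le_sq_mul_sq
    (Finset.univ : Finset (Fin n × Fin n × Fin n × Fin n))
    (fun p => W p.1 p.2.1 p.2.2.1 p.2.2.2)
    (fun p => wedgeTensor B C p.1 p.2.1 p.2.2.1 p.2.2.2)
  simp only [Fintype.sum_prod_type] at hcs
  rw [sum_mul_wedgeTensor W hanti1 hanti2 htracefree, mul_pow] at hcs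
  norm_num only at hcs
  rw [← hVV]
  exact ⟨Finset.sum_nonneg fun i _ => Finset.sum_nonneg fun j _ => Finset.sum_nonneg fun k _ =>
    Finset.sum_nonneg fun l _ => sq_nonneg _, hcs⟩

lemma sq_trace_cube_le {n : ℕ} (hn : n ≠ 0) {B : Matrix (Fin n) (Fin n) ℝ} (hB : B.IsSymm)
    (htr : B.trace = 0) :
    0 ≤ (B * B * (B * B)).trace - (B * B).trace ^ 2 / n ∧
    (B * B * B).trace ^ 2 ≤
      (B * B).trace * ((B * B * (B * B)).trace - (B * B).trace ^ 2 / n) := by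
  have hn' : (n : ℝ) ≠ 0 := by exact_mod_cast hn
  set c : ℝ := (B * B).trace / n with hc
  set D : Matrix (Fin n) (Fin n) ℝ := B * B - c • 1 with hD
  have hDs : D.IsSymm := by
    simp [hD, Matrix.IsSymm, Matrix.transpose_mul, hB.eq]
  have hDB : (D * B).trace = (B * B * B).trace := by
    simp [hD, sub_mul, htr]
  have hDD : (D * D).trace = (B * B * (B * B)).trace - (B * B).trace ^ 2 / n := by
    simp only [hD, sub_mul, mul_sub, Matrix.trace_sub, Matrix.smul_mul, Matrix.mul_smul, one_mul,
      mul_one, Matrix.trace_smul, Matrix.trace_one, smul_eq_mul, Fintype.card_fin, hc]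
    field_simp
    ring
  have hsum : (D * B).trace = ∑ i, ∑ j, D i j * B i j := by
    simp only [Matrix.trace, Matrix.diag, Matrix.mul_apply]
    exact Finset.sum_congr rfl fun i _ => Finset.sum_congr rfl fun j _ => by rw [hB.apply i j]
  have hcs := Finset.sum_mul_sq_le_sq_mul_sq (Finset.univ : Finset (Fin n × Fin n))
    (fun p => D p.1 p.2) (fun p => B p.1 p.2)
  simp only [Fintype.sum_prod_type] at hcs
  rw [← hsum, ← trace_mul_self_eq_sum_sq hDs, ← trace_mul_self_eq_sum_sq hB, hDB, hDD] at hcs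
  refine ⟨?_, by linarith⟩
  rw [← hDD, trace_mul_self_eq_sum_sq hDs]
  positivity

/-- Two Cauchy–Schwarz type bounds add up, in discriminant form. -/
lemma sq_add_le_of_sq_le_mul {x y p q r s : ℝ} (hp : 0 ≤ p) (hq : 0 ≤ q) (hr : 0 ≤ r)
    (hs : 0 ≤ s) (hx : x ^ 2 ≤ p * q) (hy : y ^ 2 ≤ r * s) :
    (x + y) ^ 2 ≤ (p + r) * (q + s) := by
  have h : (x * y) ^ 2 ≤ ((p * s + r * q) / 2) ^ 2 := by
    have := mul_le_mul hx hy (sq_nonneg y) (mul_nonneg hp hq)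
    nlinarith [sq_nonneg (p * s - r * q)]
  have := abs_le_of_sq_le_sq' h (by positivity)
  nlinarith [this.2]


/-- Remark 3.4: for any constant `K`, a totally trace-free curvature-type 4-tensor `W` on
`ℝⁿ` (`n ≥ 3`) and a symmetric trace-free matrix `B`,
`|-∑ W_{ijkl} B_{ik} B_{jl} + K tr(B³)|
  ≤ √((n-2)/(2(n-1))) ‖B‖² (‖W‖² + (2(n-2)K²/n) ‖B‖²)^(1/2)`. -/
theorem stmt_9 (n : ℕ) (hn : 3 ≤ n) (K : ℝ) (W : Fin n → Fin n → Fin n → Fin n → ℝ)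
    (hpair : ∀ i j k l, W i j k l = W k l i j)
    (hanti1 : ∀ i j k l, W i j k l = -W j i k l)
    (hanti2 : ∀ i j k l, W i j k l = -W i j l k)
    (htracefree : ∀ j l, ∑ i, W i j i l = 0)
    (B : Matrix (Fin n) (Fin n) ℝ) (hB : B.IsSymm) (htr : B.trace = 0) :
    |-(∑ i, ∑ j, ∑ k, ∑ l, W i j k l * B i k * B j l) + K * (B * B * B).trace| ≤
      Real.sqrt (((n : ℝ) - 2) / (2 * ((n : ℝ) - 1))) * (∑ i, ∑ j, B i j ^ 2) *
        Real.sqrt ((∑ i, ∑ j, ∑ k, ∑ l, W i j k l ^ 2) +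
          (2 * ((n : ℝ) - 2) * K ^ 2 / (n : ℝ)) * (∑ i, ∑ j, B i j ^ 2)) := by
  have hn' : (3 : ℝ) ≤ n := by exact_mod_cast hn
  have hn0 : (0 : ℝ) < n := by linarith
  have hn1 : 0 < (n : ℝ) - 1 := by linarith
  have hn2 : 0 < (n : ℝ) - 2 := by linarith
  obtain ⟨hv, hx⟩ := sq_sum_weyl_le hn W hanti1 hanti2 htracefree hB htr
  obtain ⟨hu, hy⟩ := sq_trace_cube_le (by omega) hB htr
  have hb0 : 0 ≤ ∑ i, ∑ j, B i j ^ 2 := by positivity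
  have hw0 : 0 ≤ ∑ i, ∑ j, ∑ k, ∑ l, W i j k l ^ 2 := by positivity
  rw [trace_mul_self_eq_sum_sq hB] at hx hy hv hu
  generalize (B * B * (B * B)).trace = t at hx hy hv hu
  generalize (B * B * B).trace = y at hy ⊢
  generalize ∑ i, ∑ j, B i j ^ 2 = b at hx hy hv hu hb0 ⊢
  generalize ∑ i, ∑ j, ∑ k, ∑ l, W i j k l * B i k * B j l = x at hx ⊢
  generalize ∑ i, ∑ j, ∑ k, ∑ l, W i j k l ^ 2 = w at hx hw0 ⊢
  set v := 2 * b ^ 2 - 2 * t - 4 / (n - 2) * t + 2 / (((n : ℝ) - 1) * (n - 2)) * b ^ 2 with hvdef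
  set u := t - b ^ 2 / n with hudef
  have hKy : (K * y) ^ 2 ≤ (2 * (n - 2) * K ^ 2 / n * b) * (n / (2 * (n - 2)) * u) := by
    have : (2 * ((n : ℝ) - 2) * K ^ 2 / n * b) * (n / (2 * (n - 2)) * u) = K ^ 2 * (b * u) := by
      field_simp
    rw [this, mul_pow]
    exact mul_le_mul_of_nonneg_left hy (sq_nonneg K)
  have key := sq_add_le_of_sq_le_mul (x := -x) (q := v / 4) hw0 (by positivity) (by positivity)
    (by positivity) (by linarith) hKy
  have hvu : v / 4 + n / (2 * (n - 2)) * u = (n - 2) / (2 * (n - 1)) * b ^ 2 := by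
    rw [hvdef, hudef]
    field_simp
    ring
  have hsqrt : √((n - 2) / (2 * (n - 1))) * b * √(w + 2 * (n - 2) * K ^ 2 / n * b) =
      √((n - 2) / (2 * (n - 1)) * b ^ 2 * (w + 2 * (n - 2) * K ^ 2 / n * b)) := by
    rw [Real.sqrt_mul (by positivity), Real.sqrt_mul (by positivity), Real.sqrt_sq hb0]
  rw [hsqrt, ← hvu, mul_comm (v / 4 + _)]
  exact Real.abs_le_sqrt key
end

section
/- Let n ≥ 2, let W be a 4-tensor on ℝⁿ with the algebraic symmetries of the Riemann curvature tensor (W_{ijkl} = W_{klij} = −W_{jikl} = −W_{ijlk}) which is totally trace-free (Σ_i W_{ijil} = 0 for all j,l), and let B be a real symmetric n×n matrix with tr(B) = 0. Then | Σ_{i,j,k,l} W_{ijkl} B_{ik} B_{jl} | ≤ √((n−2)/(2(n−1))) · ‖W‖ · ‖B‖². -/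
/-- The Kulkarni–Nomizu type square `M i k * M j l - M j k * M i l` of a matrix. -/
def wedgeSq {ι : Type*} (M : Matrix ι ι ℝ) (i j k l : ι) : ℝ :=
  M i k * M j l - M j k * M i l

section
variable {ι : Type*} [Fintype ι]

/-- Cauchy–Schwarz for 4-tensors. -/
theorem sq_sum₄_mul_le (U V : ι → ι → ι → ι → ℝ) :
    (∑ i, ∑ j, ∑ k, ∑ l, U i j k l * V i j k l) ^ 2 ≤
      (∑ i, ∑ j, ∑ k, ∑ l, U i j k l ^ 2) * ∑ i, ∑ j, ∑ k, ∑ l, V i j k l ^ 2 := by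
  simpa only [Fintype.sum_prod_type] using
    Finset.sum_mul_sq_le_sq_mul_sq (Finset.univ : Finset (ι × ι × ι × ι))
      (fun p => U p.1 p.2.1 p.2.2.1 p.2.2.2) (fun p => V p.1 p.2.1 p.2.2.1 p.2.2.2)

theorem sum_mul_wedgeSq {W : ι → ι → ι → ι → ℝ} (hW : ∀ i j k l, W i j k l = -W j i k l)
    (M : Matrix ι ι ℝ) :
    ∑ i, ∑ j, ∑ k, ∑ l, W i j k l * wedgeSq M i j k l =
      2 * ∑ i, ∑ j, ∑ k, ∑ l, W i j k l * M i k * M j l := by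
  have h : ∑ i, ∑ j, ∑ k, ∑ l, W i j k l * (M j k * M i l) =
      -∑ i, ∑ j, ∑ k, ∑ l, W i j k l * (M i k * M j l) := by
    rw [Finset.sum_comm]
    simp only [← Finset.sum_neg_distrib]
    refine Finset.sum_congr rfl fun i _ => Finset.sum_congr rfl fun j _ =>
      Finset.sum_congr rfl fun k _ => Finset.sum_congr rfl fun l _ => ?_
    rw [hW, neg_mul]
  simp only [wedgeSq, mul_sub, Finset.sum_sub_distrib, h, mul_assoc]
  ring

theorem sum_wedgeSq_mul_wedgeSq (M : Matrix ι ι ℝ) {N : Matrix ι ι ℝ} (hN : N.IsSymm) :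
    ∑ i, ∑ j, ∑ k, ∑ l, wedgeSq M i j k l * wedgeSq N i j k l =
      2 * (M * N).trace ^ 2 - 2 * (M * N * (M * N)).trace := by
  have h₁ : ∑ i, ∑ j, ∑ k, ∑ l, (M i k * N i k) * (M j l * N j l) = (M * N).trace ^ 2 := by
    simp only [pow_two, Matrix.trace, Matrix.diag, Matrix.mul_apply, Finset.sum_mul_sum]
    refine Finset.sum_congr rfl fun i _ => Finset.sum_congr rfl fun j _ =>
      Finset.sum_congr rfl fun k _ => Finset.sum_congr rfl fun l _ => ?_
    rw [hN.apply i k, hN.apply j l]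
  have h₂ : ∑ i, ∑ j, ∑ k, ∑ l, (M i k * N j k) * (M j l * N i l) =
      (M * N * (M * N)).trace := by
    simp only [Matrix.trace, Matrix.diag, Matrix.mul_apply (M := M * N), Matrix.mul_apply (M := M),
      Finset.sum_mul_sum]
    refine Finset.sum_congr rfl fun i _ => Finset.sum_congr rfl fun j _ =>
      Finset.sum_congr rfl fun k _ => Finset.sum_congr rfl fun l _ => ?_
    rw [hN.apply j k, hN.apply i l]
  have h₃ : ∑ i, ∑ j, ∑ k, ∑ l, (M j k * N j k) * (M i l * N i l) = (M * N).trace ^ 2 := by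
    rw [Finset.sum_comm, h₁]
  have h₄ : ∑ i, ∑ j, ∑ k, ∑ l, (M j k * N i k) * (M i l * N j l) =
      (M * N * (M * N)).trace := by
    rw [Finset.sum_comm, h₂]
  rw [two_mul, two_mul]
  nth_rw 1 [← h₁]
  rw [← h₃]
  nth_rw 1 [← h₂]
  rw [← h₄]
  simp only [← Finset.sum_add_distrib, ← Finset.sum_sub_distrib]
  refine Finset.sum_congr rfl fun i _ => Finset.sum_congr rfl fun j _ =>
    Finset.sum_congr rfl fun k _ => Finset.sum_congr rfl fun l _ => ?_
  simp only [wedgeSq]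
  ring

theorem Matrix.IsSymm.sq_trace_le_card_mul_trace_mul_self {A : Matrix ι ι ℝ} (hA : A.IsSymm) :
    A.trace ^ 2 ≤ Fintype.card ι * (A * A).trace := by
  refine (sq_sum_le_card_mul_sum_sq (s := Finset.univ) (f := A.diag)).trans ?_
  refine mul_le_mul_of_nonneg_left (Finset.sum_le_sum fun i _ => ?_) (Nat.cast_nonneg _)
  rw [Matrix.diag_apply, Matrix.diag_apply, Matrix.mul_apply, pow_two]
  refine Finset.single_le_sum (f := fun j => A i j * A j i) (fun j _ => ?_) (Finset.mem_univ i)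
  rw [hA.apply i j]
  exact mul_self_nonneg _

end

/-- Huisken's inequality: for a totally trace-free curvature-type 4-tensor `W` on `ℝⁿ`
(`n ≥ 2`) and a symmetric trace-free matrix `B`,
`|∑ W_{ijkl} B_{ik} B_{jl}| ≤ √((n-2)/(2(n-1))) ‖W‖ ‖B‖²`. -/
theorem stmt_10 (n : ℕ) (hn : 2 ≤ n) (W : Fin n → Fin n → Fin n → Fin n → ℝ)
    (hpair : ∀ i j k l, W i j k l = W k l i j)
    (hanti1 : ∀ i j k l, W i j k l = -W j i k l)
    (hanti2 : ∀ i j k l, W i j k l = -W i j l k)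
    (htracefree : ∀ j l, ∑ i, W i j i l = 0)
    (B : Matrix (Fin n) (Fin n) ℝ) (hB : B.IsSymm) (htr : B.trace = 0) :
    |∑ i, ∑ j, ∑ k, ∑ l, W i j k l * B i k * B j l| ≤
      Real.sqrt (((n : ℝ) - 2) / (2 * ((n : ℝ) - 1))) *
        Real.sqrt (∑ i, ∑ j, ∑ k, ∑ l, W i j k l ^ 2) * (∑ i, ∑ j, B i j ^ 2) := by
  have hn' : (2 : ℝ) ≤ n := by exact_mod_cast hn
  set X := ∑ i, ∑ j, ∑ k, ∑ l, W i j k l * B i k * B j l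
  set S := ∑ i, ∑ j, B i j ^ 2 with hS
  set w := ∑ i, ∑ j, ∑ k, ∑ l, W i j k l ^ 2
  have hS0 : 0 ≤ S := Finset.sum_nonneg fun i _ => Finset.sum_nonneg fun j _ => sq_nonneg (B i j)
  have hw0 : 0 ≤ w := Finset.sum_nonneg fun i _ => Finset.sum_nonneg fun j _ =>
    Finset.sum_nonneg fun k _ => Finset.sum_nonneg fun l _ => sq_nonneg (W i j k l)
  have hBB : (B * B).trace = S := by
    simp only [hS, Matrix.trace, Matrix.diag, Matrix.mul_apply, pow_two]
    exact Finset.sum_congr rfl fun i _ => Finset.sum_congr rfl fun j _ => by rw [hB.apply i j]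
  have hT : S ^ 2 ≤ n * (B * B * (B * B)).trace := by
    have hsymm : (B * B).IsSymm := by
      rw [Matrix.IsSymm, Matrix.transpose_mul, hB.eq]
    simpa [hBB] using hsymm.sq_trace_le_card_mul_trace_mul_self
  have hWone : ∑ i, ∑ j, ∑ k, ∑ l,
      W i j k l * wedgeSq (1 : Matrix (Fin n) (Fin n) ℝ) i j k l = 0 := by
    rw [sum_mul_wedgeSq hanti1]
    simp only [Matrix.one_apply, mul_ite, mul_one, mul_zero, Finset.sum_ite_eq, Finset.mem_univ,
      if_true]
    rw [Finset.sum_comm]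
    simp [htracefree]
  have hWB := sum_mul_wedgeSq hanti1 B
  have hBB' := sum_wedgeSq_mul_wedgeSq B hB
  have hB1 := sum_wedgeSq_mul_wedgeSq B Matrix.isSymm_one
  have h11 := sum_wedgeSq_mul_wedgeSq (1 : Matrix (Fin n) (Fin n) ℝ) Matrix.isSymm_one
  simp only [Matrix.mul_one, htr, hBB, Matrix.trace_one, Fintype.card_fin] at hBB' hB1 h11
  set c : ℝ := S / (n * (n - 1)) with hc
  have key : (2 * X) ^ 2 ≤ w * (2 * S ^ 2 - 2 * (B * B * (B * B)).trace
      + 2 * c * (2 * 0 ^ 2 - 2 * S) + c ^ 2 * (2 * n ^ 2 - 2 * n)) := by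
    have h := sq_sum₄_mul_le W (fun i j k l => wedgeSq B i j k l + c * wedgeSq 1 i j k l)
    have e1 : ∑ i, ∑ j, ∑ k, ∑ l, W i j k l * (wedgeSq B i j k l + c * wedgeSq 1 i j k l)
        = 2 * X := by
      simp only [mul_add, Finset.sum_add_distrib, mul_left_comm _ c, ← Finset.mul_sum]
      rw [hWone, hWB, mul_zero, add_zero]
    have e2 : ∑ i, ∑ j, ∑ k, ∑ l, (wedgeSq B i j k l + c * wedgeSq 1 i j k l) ^ 2
        = 2 * S ^ 2 - 2 * (B * B * (B * B)).trace
          + 2 * c * (2 * 0 ^ 2 - 2 * S) + c ^ 2 * (2 * n ^ 2 - 2 * n) := by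
      rw [← hBB', ← hB1, ← h11]
      simp only [Finset.mul_sum, ← Finset.sum_add_distrib]
      refine Finset.sum_congr rfl fun i _ => Finset.sum_congr rfl fun j _ =>
        Finset.sum_congr rfl fun k _ => Finset.sum_congr rfl fun l _ => ?_
      ring
    rwa [e1, e2] at h
  clear_value X S w
  have hn0 : (0 : ℝ) < n := by linarith
  have hn1 : (0 : ℝ) < (n : ℝ) - 1 := by linarith
  have hT' : S ^ 2 / n ≤ (B * B * (B * B)).trace := by
    rwa [div_le_iff₀' hn0]
  have hbound : X ^ 2 ≤ (((n : ℝ) - 2) / (2 * ((n : ℝ) - 1))) * w * S ^ 2 := by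
    have h1 : 2 * S ^ 2 - 2 * (B * B * (B * B)).trace
        + 2 * c * (2 * 0 ^ 2 - 2 * S) + c ^ 2 * (2 * n ^ 2 - 2 * n)
        ≤ 4 * ((((n : ℝ) - 2) / (2 * ((n : ℝ) - 1))) * S ^ 2) := by
      have h2 : 2 * S ^ 2 - 2 * (S ^ 2 / n)
          + 2 * c * (2 * 0 ^ 2 - 2 * S) + c ^ 2 * (2 * n ^ 2 - 2 * n)
          = 4 * ((((n : ℝ) - 2) / (2 * ((n : ℝ) - 1))) * S ^ 2) := by
        rw [hc]
        field_simp
        ring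
      linarith
    have := mul_le_mul_of_nonneg_left h1 hw0
    linarith
  have hcoef : 0 ≤ ((n : ℝ) - 2) / (2 * ((n : ℝ) - 1)) :=
    div_nonneg (by linarith) (by linarith)
  refine abs_le_of_sq_le_sq ?_ (mul_nonneg (mul_nonneg (Real.sqrt_nonneg _) (Real.sqrt_nonneg _)) hS0)
  rwa [mul_pow, mul_pow, Real.sq_sqrt hcoef, Real.sq_sqrt hw0]
end
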